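/- arXiv:1002.1106 — 2 statements merged into one kernel-verified Lean document; each statement's English description precedes it below -/
import Mathlib

section
/- Let a and b be (possibly empty) lists of integers, let m and n be integers, and let J denote the 2×2 integer matrix [[-1,0],[0,1]]. Then M(a ++ [m, -n] ++ b) = (-1)^{|b|} · M(a ++ [m-1, 1, n-1] ++ (-b)) · J, where |b| denotes the length of b and -b denotes the list b with every entry negated. Consequently, applying both sides to the column vector (1,0)ᵀ, M(a ++ [m, -n] ++ b)·(1,0)ᵀ = (-1)^{|b|+1} · M(a ++ [m-1, 1, n-1] ++ (-b))·(1,0)ᵀ, so the continued fractions r+[a, m, -n, b] and r+[a, m-1, 1, n-1, -b] determine the same rational number. (This is Lemma 4.1(i) of the paper in matrix form.) -/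
open Matrix

/-- The 2×2 integer matrix associated to a continued fraction expansion:
the product of the matrices `!![rᵢ, 1; 1, 0]` over the entries of the list,
with the empty product equal to the identity. -/
def cfM (l : List ℤ) : Matrix (Fin 2) (Fin 2) ℤ :=
  (l.map (fun r => !![r, 1; 1, 0])).prod

theorem cfM_nil : cfM [] = 1 := rfl

theorem cfM_cons (r : ℤ) (l : List ℤ) : cfM (r :: l) = !![r, 1; 1, 0] * cfM l := by
  simp [cfM]

theorem cfM_append (l₁ l₂ : List ℤ) : cfM (l₁ ++ l₂) = cfM l₁ * cfM l₂ := by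
  simp [cfM]

/-- Moving the reflection `!![-1, 0; 0, 1]` past `cfM b` negates the entries of `b`, up to sign. -/
theorem reflection_mul_cfM (b : List ℤ) :
    !![(-1 : ℤ), 0; 0, 1] * cfM b =
      ((-1 : ℤ) ^ b.length) • (cfM (b.map (fun x => -x)) * !![(-1 : ℤ), 0; 0, 1]) := by
  induction b with
  | nil => simp [cfM_nil]
  | cons r b ih =>
    have h : !![(-1 : ℤ), 0; 0, 1] * !![r, 1; 1, 0] =
        (-1 : ℤ) • (!![-r, 1; 1, 0] * !![(-1 : ℤ), 0; 0, 1]) := by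
      simp
    rw [List.map_cons, List.length_cons, cfM_cons, cfM_cons, ← Matrix.mul_assoc, h,
      Matrix.smul_mul, Matrix.mul_assoc, ih, Matrix.mul_smul, smul_smul, pow_succ',
      Matrix.mul_assoc]

theorem cfM_pair_neg (m n : ℤ) :
    cfM [m, -n] = cfM [m - 1, 1, n - 1] * !![(-1 : ℤ), 0; 0, 1] := by
  simp only [cfM_cons, cfM_nil, Matrix.mul_one, Matrix.mul_fin_two]
  congr 1
  ring_nf

/-- Lemma 4.1(i) of the paper, in matrix form:
`M(a ++ [m, -n] ++ b) = (-1)^{|b|} • M(a ++ [m-1, 1, n-1] ++ (-b)) * J`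
where `J = !![-1, 0; 0, 1]`, and consequently both sides applied to `(1,0)ᵀ`
agree up to the sign `(-1)^{|b|+1}`. -/
theorem cfM_insert_neg (a b : List ℤ) (m n : ℤ) :
    cfM (a ++ [m, -n] ++ b) =
      ((-1 : ℤ) ^ b.length) •
        (cfM (a ++ [m - 1, 1, n - 1] ++ b.map (fun x => -x)) * !![(-1 : ℤ), 0; 0, 1]) ∧
    cfM (a ++ [m, -n] ++ b) *ᵥ ![(1 : ℤ), 0] =
      ((-1 : ℤ) ^ (b.length + 1)) •
        (cfM (a ++ [m - 1, 1, n - 1] ++ b.map (fun x => -x)) *ᵥ ![(1 : ℤ), 0]) := by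
  have key : cfM (a ++ [m, -n] ++ b) =
      ((-1 : ℤ) ^ b.length) •
        (cfM (a ++ [m - 1, 1, n - 1] ++ b.map (fun x => -x)) * !![(-1 : ℤ), 0; 0, 1]) := by
    simp only [cfM_append, cfM_pair_neg, Matrix.mul_assoc, reflection_mul_cfM, Matrix.mul_smul]
  refine ⟨key, ?_⟩
  have hJ : !![(-1 : ℤ), 0; 0, 1] *ᵥ ![(1 : ℤ), 0] = (-1 : ℤ) • ![(1 : ℤ), 0] := by
    decide
  rw [key, Matrix.smul_mulVec, ← Matrix.mulVec_mulVec, hJ, Matrix.mulVec_smul, smul_smul,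
    pow_succ]
end

section
/- Let a and b be positive integers. If the polynomial (b+1)² + (4-2(b+1)²)X + (b+1)²X² divides the polynomial (a+1)² + (4-2(a+1)²)X + (a+1)²X² in ℚ[X], then a = b. (This is the Alexander-polynomial divisibility step in Case (3ᵢᵢᵢ, 3ᵢᵢᵢ) of the proof of Theorem 5.1 of the paper: up to the unit 4, the Alexander polynomial of the 2-bridge knot K[c,1,c] is (c+1)² + (4-2(c+1)²)t + (c+1)²t², and divisibility forces the two knots to coincide.) -/
open Polynomial

/-- The Alexander-polynomial divisibility step in Case (3ᵢᵢᵢ, 3ᵢᵢᵢ) of Theorem 5.1: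
for positive integers `a` and `b`, if `(b+1)² + (4-2(b+1)²)X + (b+1)²X²` divides
`(a+1)² + (4-2(a+1)²)X + (a+1)²X²` in `ℚ[X]`, then `a = b`. -/
theorem alexander_div_case_3iii_3iii (a b : ℤ) (ha : 0 < a) (hb : 0 < b)
    (hdvd : (C (((b + 1) ^ 2 : ℤ) : ℚ) + C ((4 - 2 * (b + 1) ^ 2 : ℤ) : ℚ) * X +
        C (((b + 1) ^ 2 : ℤ) : ℚ) * X ^ 2) ∣
      (C (((a + 1) ^ 2 : ℤ) : ℚ) + C ((4 - 2 * (a + 1) ^ 2 : ℤ) : ℚ) * X +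
        C (((a + 1) ^ 2 : ℤ) : ℚ) * X ^ 2)) :
    a = b := by
  have key : (C ((4 * ((a + 1) ^ 2 - (b + 1) ^ 2) : ℤ) : ℚ) * X : ℚ[X]) = 0 := by
    refine eq_zero_of_dvd_of_natDegree_lt (p := C (((b + 1) ^ 2 : ℤ) : ℚ) +
      C ((4 - 2 * (b + 1) ^ 2 : ℤ) : ℚ) * X + C (((b + 1) ^ 2 : ℤ) : ℚ) * X ^ 2) ?_ ?_
    · convert (dvd_mul_left _ (C (((a + 1) ^ 2 : ℤ) : ℚ))).sub
        (hdvd.mul_left (C (((b + 1) ^ 2 : ℤ) : ℚ))) using 1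
      simp only [Int.cast_sub, Int.cast_mul, Int.cast_ofNat, C_sub, C_mul]
      ring
    · refine ((natDegree_C_mul_le _ _).trans natDegree_X_le).trans_lt ?_
      have hdeg : (C (((b + 1) ^ 2 : ℤ) : ℚ) + C ((4 - 2 * (b + 1) ^ 2 : ℤ) : ℚ) * X +
          C (((b + 1) ^ 2 : ℤ) : ℚ) * X ^ 2).natDegree = 2 := by
        compute_degree!
        omega
      omega
  have hsq : (4 * ((a + 1) ^ 2 - (b + 1) ^ 2) : ℤ) = 0 := by
    simpa only [mul_eq_zero, X_ne_zero, or_false, C_eq_zero, Int.cast_eq_zero] using key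
  have hprod : (a - b) * (a + b + 2) = 0 := by linarith
  rcases mul_eq_zero.mp hprod with h | h <;> omega
end
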